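/- Let μ be a complex number and n ≥ 1 an integer. Then the determinant of the (2n−1)×(2n−1) matrix with rows and columns indexed by 0 ≤ i, j ≤ 2n−2 and entries −δ_{i,j} + C(μ+i+j−2, j) is zero; that is, b_{2n−1}(0,0,μ) = 0. -/

import Mathlib

/-- Generalized binomial coefficient `C(x,k) = x(x-1)⋯(x-k+1)/k!` for complex `x`. -/
noncomputable def gbinom (x : ℂ) (k : ℕ) : ℂ :=
  (∏ i ∈ Finset.range k, (x - i)) / (k.factorial : ℂ)

/-- Pochhammer symbol `(x)_k = x(x+1)⋯(x+k-1)`. -/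
noncomputable def poch (x : ℂ) (k : ℕ) : ℂ :=
  ∏ i ∈ Finset.range k, (x + i)
/-- `b_n(I,J,μ)`: determinant of the `n×n` matrix with rows indexed by
`i = I,…,n-1+I`, columns indexed by `j = J,…,n-1+J`, and entries
`-δ_{i,j} + C(μ+i+j-2, j)`. -/
noncomputable def bdet (μ : ℂ) (n I J : ℕ) : ℂ :=
  Matrix.det (Matrix.of fun i j : Fin n =>
    (if I + i.1 = J + j.1 then (-1 : ℂ) else 0)
      + gbinom (μ + ((I + i.1 : ℕ) : ℂ) + ((J + j.1 : ℕ) : ℂ) - 2) (J + j.1))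

theorem gbinom_eq_choose (x : ℂ) (k : ℕ) : gbinom x k = Ring.choose x k := by
  have h := Ring.descPochhammer_eq_factorial_smul_choose x k
  rw [Polynomial.descPochhammer_smeval_eq_ascPochhammer,
    Polynomial.ascPochhammer_smeval_eq_eval,
    ← descPochhammer_eval_eq_ascPochhammer, descPochhammer_eval_eq_prod_range,
    nsmul_eq_mul] at h
  rw [gbinom, h, mul_div_cancel_left₀ _ (by exact_mod_cast k.factorial_ne_zero)]

/-- The upper unitriangular matrix with entries `C(a+j, j-i)` for `i ≤ j`. -/
noncomputable def upperPascal (a : ℂ) (n : ℕ) : Matrix (Fin n) (Fin n) ℂ :=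
  Matrix.of fun i j => if i.1 ≤ j.1 then Ring.choose (a + j.1) (j.1 - i.1) else 0

/-- The diagonal matrix of alternating signs. -/
def signDiagonal (n : ℕ) : Matrix (Fin n) (Fin n) ℂ :=
  Matrix.diagonal fun i => (-1) ^ i.1

theorem signDiagonal_mul_self (n : ℕ) : signDiagonal n * signDiagonal n = 1 := by
  simp [signDiagonal, ← mul_pow]

theorem det_upperPascal (a : ℂ) (n : ℕ) : (upperPascal a n).det = 1 := by
  rw [Matrix.det_of_isUpperTriangular]
  · simp [upperPascal]
  · intro i j hij
    exact if_neg (show ¬ i.1 ≤ j.1 from not_le.mpr hij)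

theorem sum_Ico_neg_one_pow_mul_choose_mul_choose (a : ℂ) {i j : ℕ} (hij : i ≤ j) :
    ∑ k ∈ Finset.Ico i (j + 1),
      Ring.choose (a + k) (k - i) * (-1) ^ k * Ring.choose (a + j) (j - k) =
    if i = j then (-1) ^ i else 0 := by
  obtain ⟨d, rfl⟩ := Nat.exists_eq_add_of_le hij
  have key : ∀ m ∈ Finset.range (d + 1),
      Ring.choose (a + (i + m : ℕ)) (i + m - i) * (-1) ^ (i + m) *
        Ring.choose (a + (i + d : ℕ)) (i + d - (i + m)) =
      Ring.choose (a + (i + d : ℕ)) d * (-1) ^ i * ((-1) ^ m * (d.choose m : ℂ)) := by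
    intro m hm
    have hm : m ≤ d := Nat.lt_succ_iff.mp (Finset.mem_range.mp hm)
    have h := Ring.choose_smul_choose (a + (i + d : ℕ)) (Nat.sub_le d m)
    rw [Nat.choose_symm hm, Nat.sub_sub_self hm, nsmul_eq_mul, Nat.cast_sub hm] at h
    have e : a + ((i + d : ℕ) : ℂ) - ((d : ℂ) - m) = a + (i + m : ℕ) := by push_cast; ring
    rw [e] at h
    rw [Nat.add_sub_cancel_left, Nat.add_sub_add_left, pow_add]
    linear_combination (-(-1) ^ i * (-1) ^ m) * h
  rw [Finset.sum_Ico_eq_sum_range, show i + d + 1 - i = d + 1 by omega,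
    Finset.sum_congr rfl key, ← Finset.mul_sum]
  have h := congrArg (Int.cast : ℤ → ℂ) (Int.alternating_sum_range_choose (n := d))
  push_cast at h
  rw [h]
  by_cases hd : d = 0 <;> simp [hd]

theorem upperPascal_mul_signDiagonal_mul_upperPascal (a : ℂ) (n : ℕ) :
    upperPascal a n * signDiagonal n * upperPascal a n = signDiagonal n := by
  ext i j
  rw [Matrix.mul_apply]
  simp only [signDiagonal, Matrix.mul_diagonal, upperPascal, Matrix.of_apply,
    Matrix.diagonal_apply, Fin.ext_iff]
  rw [← Finset.sum_range fun k => (if i.1 ≤ k then Ring.choose (a + k) (k - i.1) else 0) *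
    (-1) ^ k * (if k ≤ j.1 then Ring.choose (a + j.1) (j.1 - k) else 0)]
  by_cases hij : i.1 ≤ j.1
  · rw [← sum_Ico_neg_one_pow_mul_choose_mul_choose a hij]
    symm
    refine Finset.sum_subset_zero_on_sdiff ?_ ?_ ?_
    · intro k hk
      simp only [Finset.mem_Ico, Finset.mem_range] at hk ⊢
      omega
    · intro k hk
      simp only [Finset.mem_sdiff, Finset.mem_range, Finset.mem_Ico] at hk
      by_cases h : i.1 ≤ k
      · rw [if_neg (show ¬ k ≤ j.1 by omega), mul_zero]
      · rw [if_neg h, zero_mul, zero_mul]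
    · intro k hk
      rw [Finset.mem_Ico] at hk
      rw [if_pos hk.1, if_pos (by omega)]
  · rw [if_neg (by omega)]
    refine Finset.sum_eq_zero fun k _ => ?_
    by_cases h : i.1 ≤ k
    · rw [if_neg (show ¬ k ≤ j.1 by omega), mul_zero]
    · rw [if_neg h, zero_mul, zero_mul]

theorem transpose_upperPascal_mul_upperPascal_apply (a : ℂ) (n : ℕ) (i j : Fin n) :
    ((upperPascal 0 n).transpose * upperPascal a n) i j =
      Ring.choose ((i.1 : ℂ) + (a + j.1)) j.1 := by
  rw [Ring.add_choose_eq _ (Commute.all _ _), Finset.Nat.sum_antidiagonal_eq_sum_range_succ_mk,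
    Matrix.mul_apply]
  simp only [Matrix.transpose_apply, upperPascal, Matrix.of_apply, zero_add,
    Ring.choose_natCast]
  rw [← Finset.sum_range fun k => (if k ≤ i.1 then ((i.1.choose (i.1 - k) : ℕ) : ℂ) else 0) *
    (if k ≤ j.1 then Ring.choose (a + j.1) (j.1 - k) else 0)]
  symm
  refine Finset.sum_subset_zero_on_sdiff ?_ ?_ ?_
  · intro k hk
    simp only [Finset.mem_range] at hk ⊢
    omega
  · intro k hk
    simp only [Finset.mem_sdiff, Finset.mem_range] at hk
    rw [if_neg (show ¬ k ≤ j.1 by omega), mul_zero]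
  · intro k hk
    rw [Finset.mem_range] at hk
    rw [if_pos (show k ≤ j.1 by omega)]
    by_cases h : k ≤ i.1
    · rw [if_pos h, Nat.choose_symm h]
    · rw [if_neg h, Nat.choose_eq_zero_of_lt (by omega), Nat.cast_zero]

/-- If `D` is an involution with `L D L = D = U D U` and `det (L U) = 1`, then `L U` is similar
to its inverse, so `1` is an eigenvalue of `L U` in odd dimension. -/
theorem det_mul_sub_one_eq_zero {n : ℕ} (hn : Odd n) {L U D : Matrix (Fin n) (Fin n) ℂ}
    (hD : D * D = 1) (hL : L * D * L = D) (hU : U * D * U = D) (hdet : (L * U).det = 1) :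
    (L * U - 1).det = 0 := by
  have hinv : L * U * (D * (U * L) * D) = 1 := by
    calc L * U * (D * (U * L) * D) = L * (U * D * U) * L * D := by simp only [mul_assoc]
      _ = 1 := by rw [hU, hL, hD]
  have hfac : L * U - 1 = L * U * (D * (1 - U * L) * D) := by
    rw [mul_sub, sub_mul, mul_sub, hinv, mul_one, hD, mul_one]
  have hDdet : D.det * D.det = 1 := by rw [← Matrix.det_mul, hD, Matrix.det_one]
  have h1 : (L * U - 1).det = (1 - L * U).det := by
    rw [hfac, Matrix.det_mul, hdet, Matrix.det_mul, Matrix.det_mul,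
      Matrix.det_one_sub_mul_comm U L]
    linear_combination (1 - L * U).det * hDdet
  have h2 : (1 - L * U).det = -(L * U - 1).det := by
    rw [← neg_sub, Matrix.det_neg, Fintype.card_fin, hn.neg_one_pow, neg_one_mul]
  linear_combination (h1 + h2) / 2

/-- The odd-dimensional determinant `b_{2n-1}(0,0,μ)` vanishes. -/
theorem b00_odd_vanishes (μ : ℂ) (n : ℕ) (hn : 1 ≤ n) :
    bdet μ (2 * n - 1) 0 0 = 0 := by
  have hU := upperPascal_mul_signDiagonal_mul_upperPascal
  rw [← det_mul_sub_one_eq_zero (n := 2 * n - 1) ⟨n - 1, by omega⟩ (signDiagonal_mul_self _)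
    (L := (upperPascal 0 _).transpose) (U := upperPascal (μ - 2) _) ?_ (hU _ _) ?_, bdet]
  · congr 1
    ext i j
    rw [Matrix.sub_apply, transpose_upperPascal_mul_upperPascal_apply, Matrix.of_apply,
      gbinom_eq_choose, Matrix.one_apply]
    simp only [zero_add, Fin.ext_iff]
    rw [show μ + (i.1 : ℂ) + j.1 - 2 = i.1 + (μ - 2 + j.1) by ring]
    split_ifs <;> ring
  · simpa [signDiagonal, Matrix.transpose_mul, mul_assoc] using
      congrArg Matrix.transpose (hU 0 (2 * n - 1))
  · rw [Matrix.det_mul, Matrix.det_transpose, det_upperPascal, det_upperPascal, one_mul]
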